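/- Basic counting estimate for the fractional wave phase (Lemma 3.1): Let 1 < α ≤ 2. There exists a constant C = C(α) > 0 such that for all dyadic numbers N, A ≥ 1, every a ∈ ℤ³ with |a| ∼ A, every sign ς ∈ {−1, +1}, and every ζ ∈ ℝ, the cardinality of the set { n ∈ ℤ³ : |n| ∼ N and |⟪a+n⟫ + ς·⟪n⟫ − ζ| ≤ 1 } is at most C · min(A, N)^{−1} · N³. -/

import Mathlib

noncomputable section

open scoped BigOperators

/-- Japanese bracket of a real number: `⟨x⟩ = (1 + x²)^{1/2}`. -/
def rjb (x : ℝ) : ℝ := Real.sqrt (1 + x ^ 2)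

/-- Euclidean norm of a lattice point in `ℤ³`. -/
def znorm (n : Fin 3 → ℤ) : ℝ := Real.sqrt (∑ i, ((n i : ℝ)) ^ 2)

/-- Japanese bracket `⟨n⟩ = (1 + |n|²)^{1/2}` of a lattice point in `ℤ³`. -/
def jb (n : Fin 3 → ℤ) : ℝ := Real.sqrt (1 + ∑ i, ((n i : ℝ)) ^ 2)

/-- The modified bracket `⟪n⟫ = (⟨n⟩^{2α} − 1/4)^{1/2}`. -/
def jbb (α : ℝ) (n : Fin 3 → ℤ) : ℝ := Real.sqrt (jb n ^ (2 * α) - 1 / 4)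

/-- Dyadic numbers `2^j`, `j ≥ 0`. -/
def IsDyadic (N : ℝ) : Prop := ∃ j : ℕ, N = 2 ^ j

/-- `|n| ∼ N` for a dyadic number `N`: `N/2 < |n| ≤ N` if `N ≥ 2`, and `|n| ≤ 1` if `N = 1`. -/
def SimFreq (N : ℝ) (n : Fin 3 → ℤ) : Prop :=
  (2 ≤ N ∧ N / 2 < znorm n ∧ znorm n ≤ N) ∨ (N < 2 ∧ znorm n ≤ 1)

/-- `x` is a sign `±1`. -/
def IsSign (x : ℝ) : Prop := x = 1 ∨ x = -1

open Classical in
/-- Real-valued indicator of a proposition. -/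
def ind (p : Prop) : ℝ := if p then 1 else 0

/-! ### Counting lattice points -/

/-- A finite set of lattice points in a cube of half-side `ρ ≥ 1` has at most `27 ρ³` elements. -/
lemma card_le_of_mem_cube (T : Finset (Fin 3 → ℤ)) (c : Fin 3 → ℝ) (ρ : ℝ) (hρ : 1 ≤ ρ)
    (hT : ∀ n ∈ T, ∀ i, |(n i : ℝ) - c i| ≤ ρ) : (T.card : ℝ) ≤ 27 * ρ ^ 3 := by
  have hsub : T ⊆ Fintype.piFinset fun i => Finset.Icc ⌈c i - ρ⌉ ⌊c i + ρ⌋ := by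
    intro n hn
    rw [Fintype.mem_piFinset]
    intro i
    have h := abs_le.1 (hT n hn i)
    rw [Finset.mem_Icc, Int.ceil_le, Int.le_floor]
    constructor <;> linarith
  have hcard := Finset.card_le_card hsub
  rw [Fintype.card_piFinset] at hcard
  have hside : ∀ i, ((Finset.Icc ⌈c i - ρ⌉ ⌊c i + ρ⌋).card : ℝ) ≤ 3 * ρ := by
    intro i
    rw [Int.card_Icc]
    have h₁ := Int.le_ceil (c i - ρ)
    have h₂ := Int.floor_le (c i + ρ)
    have h₃ : (((⌊c i + ρ⌋ + 1 - ⌈c i - ρ⌉).toNat : ℤ) : ℝ) ≤ 3 * ρ := by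
      rw [Int.toNat_eq_max]
      push_cast
      exact max_le (by linarith) (by linarith)
    exact_mod_cast h₃
  calc (T.card : ℝ) ≤ ∏ i, ((Finset.Icc ⌈c i - ρ⌉ ⌊c i + ρ⌋).card : ℝ) := by exact_mod_cast hcard
    _ ≤ ∏ _i : Fin 3, 3 * ρ := Finset.prod_le_prod (fun _ _ => by positivity) fun i _ => hside i
    _ = 27 * ρ ^ 3 := by simp; ring

/-- If every line in direction `v` meets `T` in a set of diameter at most `X` steps, then `T`
is smaller than the surrounding cube by a factor comparable to `X / ρ`. -/
lemma card_le_of_step_bound (T : Finset (Fin 3 → ℤ)) (c : Fin 3 → ℝ) (ρ K X : ℝ) (hρ : 1 ≤ ρ)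
    (hK : 0 ≤ K) (hX : 0 ≤ X) (v : Fin 3 → ℤ) (hv : ∀ i, |(v i : ℝ)| ≤ K)
    (hT : ∀ n ∈ T, ∀ i, |(n i : ℝ) - c i| ≤ ρ)
    (hstep : ∀ n ∈ T, ∀ k : ℕ, n + (k : ℤ) • v ∈ T → (k : ℝ) ≤ X) :
    (T.card : ℝ) ≤ 27 * (1 + 2 * K) ^ 3 * ρ ^ 2 * (X + 1) := by
  obtain ⟨L, hL⟩ : ∃ L : ℕ, L = ⌊X⌋₊ + 1 := ⟨_, rfl⟩
  have hLX : (L : ℝ) ≤ X + 1 := by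
    rw [hL]; push_cast; linarith [Nat.floor_le hX]
  have hXL : X < L := by rw [hL]; push_cast; exact Nat.lt_floor_add_one X
  have hL0 : (0 : ℝ) < L := by linarith
  have hK3 : (1 : ℝ) ≤ (1 + 2 * K) ^ 3 := one_le_pow₀ (by linarith)
  suffices h : (T.card : ℝ) ≤ 27 * (1 + 2 * K) ^ 3 * ρ ^ 2 * L from h.trans (by gcongr)
  rcases lt_or_ge ρ L with hρL | hρL
  · calc (T.card : ℝ) ≤ 27 * ρ ^ 3 := card_le_of_mem_cube T c ρ hρ hT
      _ = 27 * 1 * ρ ^ 2 * ρ := by ring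
      _ ≤ 27 * (1 + 2 * K) ^ 3 * ρ ^ 2 * L := by gcongr
  · obtain ⟨J, hJ⟩ : ∃ J : ℕ, J = ⌈ρ / L⌉₊ := ⟨_, rfl⟩
    have hJ₁ : ρ / L ≤ J := hJ ▸ Nat.le_ceil _
    have hJ₂ : (J : ℝ) < ρ / L + 1 := hJ ▸ Nat.ceil_lt_add_one (by positivity)
    have hJL : (J : ℝ) * L ≤ 2 * ρ := by
      calc (J : ℝ) * L ≤ (ρ / L + 1) * L := by gcongr
        _ = ρ + L := by field_simp
        _ ≤ 2 * ρ := by linarith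
    let f : (Fin 3 → ℤ) × ℕ → Fin 3 → ℤ := fun x => x.1 + ((x.2 * L : ℕ) : ℤ) • v
    have hlt : ∀ n ∈ T, ∀ m ∈ T, ∀ j l : ℕ, f (n, j) = f (m, l) → ¬ j < l := by
      intro n hn m hm j l h hjl
      obtain ⟨d, rfl⟩ := Nat.exists_eq_add_of_lt hjl
      have hmn : m + (((d + 1) * L : ℕ) : ℤ) • v = n := by
        funext i
        have hi := congrFun h i
        simp only [f, Pi.add_apply, Pi.smul_apply, smul_eq_mul] at hi ⊢
        push_cast at hi ⊢
        linear_combination -hi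
      have hle := hstep m hm ((d + 1) * L) (hmn.symm ▸ hn)
      push_cast at hle
      nlinarith [(Nat.cast_nonneg d : (0 : ℝ) ≤ d)]
    have hinj : Set.InjOn f (T ×ˢ Finset.range J : Finset _) := by
      rintro ⟨n, j⟩ hn ⟨m, l⟩ hm h
      simp only [Finset.coe_product, Set.mem_prod, Finset.mem_coe] at hn hm
      have hjl : j = l := le_antisymm
        (not_lt.1 (hlt m hm.1 n hn.1 l j h.symm)) (not_lt.1 (hlt n hn.1 m hm.1 j l h))
      subst hjl
      simpa [f] using h
    have hcube : ∀ n ∈ (T ×ˢ Finset.range J).image f, ∀ i,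
        |(n i : ℝ) - c i| ≤ (1 + 2 * K) * ρ := by
      intro n hn i
      obtain ⟨⟨m, j⟩, hm, rfl⟩ := Finset.mem_image.1 hn
      rw [Finset.mem_product, Finset.mem_range] at hm
      have hj : (j : ℝ) ≤ J := by exact_mod_cast hm.2.le
      have hjL : (j : ℝ) * L ≤ 2 * ρ := le_trans (by gcongr) hJL
      have heq : ((f (m, j) i : ℤ) : ℝ) - c i = ((m i : ℝ) - c i) + (j * L) * v i := by
        simp only [f, Pi.add_apply, Pi.smul_apply, smul_eq_mul]
        push_cast; ring
      rw [heq]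
      calc |((m i : ℝ) - c i) + (j * L) * v i| ≤ |(m i : ℝ) - c i| + |(j * L) * (v i : ℝ)| :=
            abs_add_le _ _
        _ = |(m i : ℝ) - c i| + j * L * |(v i : ℝ)| := by
            rw [abs_mul, abs_of_nonneg (by positivity : (0 : ℝ) ≤ j * L)]
        _ ≤ ρ + 2 * ρ * K := by
            gcongr
            · exact hT m hm.1 i
            · exact hv i
        _ = (1 + 2 * K) * ρ := by ring
    have h := card_le_of_mem_cube _ c _ (by nlinarith) hcube
    rw [Finset.card_image_of_injOn hinj, Finset.card_product, Finset.card_range] at h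
    push_cast at h
    have hTJ : (T.card : ℝ) * (ρ / L) ≤ 27 * ((1 + 2 * K) * ρ) ^ 3 := le_trans (by gcongr) h
    rw [mul_div_assoc', div_le_iff₀ hL0] at hTJ
    refine le_of_mul_le_mul_right (hTJ.trans_eq ?_) (by linarith : 0 < ρ)
    ring

/-! ### The gradient of `⟨x⟩ ^ α` -/

/-- Comparison of the radial weights at radii `Q ≤ P`. -/
lemma rpow_weight_facts {α P Q : ℝ} (hα₁ : 1 < α) (hα₂ : α ≤ 2) (hQ : 1 ≤ Q) (hQP : Q ≤ P) :
    P ^ (α - 2) ≤ Q ^ (α - 2) ∧ Q ^ (α - 2) * Q ≤ P ^ (α - 2) * P ∧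
      (α - 1) * P ^ (α - 2) * (P - Q) ≤ P ^ (α - 2) * P - Q ^ (α - 2) * Q ∧
      P⁻¹ ≤ P ^ (α - 2) := by
  have hQ0 : 0 < Q := by linarith
  have hP0 : 0 < P := by linarith
  have hmul : ∀ {r : ℝ}, 0 < r → r ^ (α - 2) * r = r ^ (α - 1) := by
    intro r hr
    rw [← Real.rpow_add_one hr.ne']; congr 1; ring
  refine ⟨Real.rpow_le_rpow_of_nonpos hQ0 hQP (by linarith), ?_, ?_, ?_⟩
  · rw [hmul hQ0, hmul hP0]
    exact Real.rpow_le_rpow hQ0.le hQP (by linarith)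
  · have h := rpow_one_add_le_one_add_mul_self
      (show -1 ≤ Q / P - 1 by have : 0 ≤ Q / P := by positivity
                              linarith)
      (show 0 ≤ α - 1 by linarith) (by linarith)
    rw [add_sub_cancel, Real.div_rpow hQ0.le hP0.le, div_le_iff₀ (by positivity)] at h
    have heq : (1 + (α - 1) * (Q / P - 1)) * P ^ (α - 1) =
        P ^ (α - 2) * P - (α - 1) * P ^ (α - 2) * (P - Q) := by
      rw [← hmul hP0]; field_simp; ring
    rw [hmul hQ0]
    linarith
  · rw [← Real.rpow_neg_one]
    exact Real.rpow_le_rpow_of_exponent_le (by linarith) (by linarith)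

section Gradient

variable {E : Type*} [NormedAddCommGroup E]

/-- Japanese bracket `⟨x⟩ = (1 + |x|²)^{1/2}` on a normed group. -/
def bracket (x : E) : ℝ := Real.sqrt (1 + ‖x‖ ^ 2)

lemma sq_bracket (x : E) : bracket x ^ 2 = 1 + ‖x‖ ^ 2 := Real.sq_sqrt (by positivity)

lemma one_le_bracket (x : E) : 1 ≤ bracket x := Real.one_le_sqrt.2 (by nlinarith [norm_nonneg x])

lemma norm_le_bracket (x : E) : ‖x‖ ≤ bracket x := Real.le_sqrt_of_sq_le (by linarith)

lemma bracket_le (x : E) : bracket x ≤ 1 + ‖x‖ :=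
  Real.sqrt_le_iff.2 ⟨by positivity, by nlinarith [norm_nonneg x]⟩

@[simp] lemma bracket_neg (x : E) : bracket (-x) = bracket x := by simp [bracket]

lemma inv_le_bracket_rpow {α M : ℝ} (hα₁ : 1 < α) (hα₂ : α ≤ 2) {p : E} (hp : bracket p ≤ M) :
    M⁻¹ ≤ bracket p ^ (α - 2) := by
  have h := one_le_bracket p
  exact (inv_anti₀ (by linarith) hp).trans (rpow_weight_facts hα₁ hα₂ h le_rfl).2.2.2

variable [InnerProductSpace ℝ E]

lemma one_add_inner_le (x y : E) : 1 + inner ℝ x y ≤ bracket x * bracket y := by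
  have h := real_inner_le_norm x y
  have h₂ : 1 + ‖x‖ * ‖y‖ ≤ bracket x * bracket y := by
    rw [bracket, bracket, ← Real.sqrt_mul (by positivity)]
    exact Real.le_sqrt_of_sq_le (by nlinarith [sq_nonneg (‖x‖ - ‖y‖)])
  linarith

lemma sq_bracket_sub_le (x y : E) : (bracket x - bracket y) ^ 2 ≤ ‖x - y‖ ^ 2 := by
  rw [norm_sub_sq_real]
  nlinarith [one_add_inner_le x y, sq_bracket x, sq_bracket y]

/-- The gradient of `⟨x⟩ ^ α`, up to the factor `α`. -/
def gradBracket (α : ℝ) (x : E) : E := bracket x ^ (α - 2) • x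

lemma gradBracket_neg (α : ℝ) (x : E) : gradBracket α (-x) = -gradBracket α x := by
  simp [gradBracket]

lemma bracket_rpow_tangent {α : ℝ} (hα : 1 ≤ α) (x y : E) :
    α * inner ℝ (gradBracket α x) (y - x) ≤ bracket y ^ α - bracket x ^ α := by
  have hx := one_le_bracket x
  have hy := one_le_bracket y
  have hx0 : 0 < bracket x := by linarith
  have hB := one_add_mul_self_le_rpow_one_add
    (show -1 ≤ bracket y / bracket x - 1 by have : 0 ≤ bracket y / bracket x := by positivity
                                            linarith) hα
  rw [add_sub_cancel, Real.div_rpow (by linarith) (by linarith),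
    le_div_iff₀ (by positivity)] at hB
  have hpow : bracket x ^ α = bracket x ^ (α - 2) * bracket x ^ 2 := by
    rw [← Real.rpow_natCast, ← Real.rpow_add hx0]; norm_num
  have hin : inner ℝ x (y - x) ≤ bracket x * bracket y - bracket x ^ 2 := by
    rw [inner_sub_right, real_inner_self_eq_norm_sq, sq_bracket]
    linarith [one_add_inner_le x y]
  rw [gradBracket, real_inner_smul_left]
  have hw : 0 ≤ α * bracket x ^ (α - 2) := by positivity
  have h := mul_le_mul_of_nonneg_left hin hw
  have heq : (1 + α * (bracket y / bracket x - 1)) * bracket x ^ α = bracket x ^ α +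
      α * bracket x ^ (α - 2) * (bracket x * bracket y - bracket x ^ 2) := by
    rw [hpow]; field_simp
  linarith

lemma hasDerivAt_bracket_rpow (α : ℝ) (x v : E) (s : ℝ) :
    HasDerivAt (fun s : ℝ => bracket (x + s • v) ^ α)
      (α * inner ℝ (gradBracket α (x + s • v)) v) s := by
  have h₁ : HasDerivAt (fun s : ℝ => x + s • v) v s := by
    simpa using ((hasDerivAt_id s).smul_const v).const_add x
  have h₂ := (h₁.norm_sq.const_add 1).sqrt (by positivity)
  have h₃ := h₂.rpow_const (p := α)
    (Or.inl (by have := one_le_bracket (x + s • v); rw [bracket] at this; linarith))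
  refine h₃.congr_deriv ?_
  have h0 : 0 < bracket (x + s • v) := by linarith [one_le_bracket (x + s • v)]
  have hsplit : bracket (x + s • v) ^ (α - 1) = bracket (x + s • v) ^ (α - 2) *
      bracket (x + s • v) := by
    rw [← Real.rpow_add_one h0.ne']; congr 1; ring
  change 2 * inner ℝ (x + s • v) v / (2 * bracket (x + s • v)) * α *
    bracket (x + s • v) ^ (α - 1) = _
  rw [hsplit, gradBracket, real_inner_smul_left]
  field_simp

lemma gradBracket_monotone_of_le {α : ℝ} (hα₁ : 1 < α) (hα₂ : α ≤ 2) (p q : E)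
    (h : bracket q ≤ bracket p) :
    (α - 1) * bracket p ^ (α - 2) * ‖p - q‖ ^ 2 ≤
      inner ℝ (gradBracket α p - gradBracket α q) (p - q) := by
  obtain ⟨h₁, -, h₃, -⟩ := rpow_weight_facts hα₁ hα₂ (one_le_bracket q) h
  have hD := sq_bracket_sub_le p q
  have hp0 : 0 ≤ bracket p ^ (α - 2) := by have := one_le_bracket p; positivity
  simp only [gradBracket] at *
  set a := bracket p ^ (α - 2)
  set b := bracket q ^ (α - 2)
  have hexp : inner ℝ (a • p - b • q) (p - q) =
      (a + b) / 2 * (‖p - q‖ ^ 2 - (bracket p - bracket q) ^ 2) +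
        (bracket p - bracket q) * (a * bracket p - b * bracket q) := by
    have hp := sq_bracket p
    have hq := sq_bracket q
    rw [norm_sub_sq_real]
    simp only [inner_sub_left, inner_sub_right, real_inner_smul_left, real_inner_self_eq_norm_sq,
      real_inner_comm p q]
    linear_combination (-(a - b) / 2 : ℝ) * hp + ((a - b) / 2 : ℝ) * hq
  rw [hexp]
  have e₁ : a * (‖p - q‖ ^ 2 - (bracket p - bracket q) ^ 2) ≤
      (a + b) / 2 * (‖p - q‖ ^ 2 - (bracket p - bracket q) ^ 2) :=
    mul_le_mul_of_nonneg_right (by linarith) (by linarith)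
  have e₂ := mul_le_mul_of_nonneg_left h₃ (sub_nonneg.2 h)
  have e₃ : 0 ≤ (2 - α) * (a * (‖p - q‖ ^ 2 - (bracket p - bracket q) ^ 2)) :=
    mul_nonneg (by linarith) (mul_nonneg hp0 (by linarith))
  nlinarith

lemma norm_gradBracket_sub_le_of_le {α : ℝ} (hα₁ : 1 < α) (hα₂ : α ≤ 2) (p q : E)
    (h : bracket q ≤ bracket p) :
    ‖gradBracket α p - gradBracket α q‖ ≤ 2 * bracket p ^ (α - 2) * ‖p - q‖ := by
  obtain ⟨h₁, h₂, -, -⟩ := rpow_weight_facts hα₁ hα₂ (one_le_bracket q) h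
  have hD := abs_le_of_sq_le_sq' (sq_bracket_sub_le p q) (norm_nonneg _)
  have hp0 : 0 ≤ bracket p ^ (α - 2) := by have := one_le_bracket p; positivity
  simp only [gradBracket] at *
  set a := bracket p ^ (α - 2)
  set b := bracket q ^ (α - 2)
  have heq : a • p - b • q = a • (p - q) - (b - a) • q := by module
  calc ‖a • p - b • q‖ ≤ ‖a • (p - q)‖ + ‖(b - a) • q‖ := heq ▸ norm_sub_le _ _
    _ = a * ‖p - q‖ + (b - a) * ‖q‖ := by
        rw [norm_smul, norm_smul, Real.norm_of_nonneg hp0, Real.norm_of_nonneg (by linarith)]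
    _ ≤ a * ‖p - q‖ + (b - a) * bracket q := by
        gcongr
        exact norm_le_bracket q
    _ ≤ 2 * a * ‖p - q‖ := by nlinarith [mul_le_mul_of_nonneg_left hD.2 hp0]

lemma gradBracket_monotone {α M : ℝ} (hα₁ : 1 < α) (hα₂ : α ≤ 2) (p q : E)
    (hp : bracket p ≤ M) (hq : bracket q ≤ M) :
    (α - 1) * M⁻¹ * ‖p - q‖ ^ 2 ≤ inner ℝ (gradBracket α p - gradBracket α q) (p - q) := by
  have hα : 0 ≤ α - 1 := by linarith
  rcases le_total (bracket q) (bracket p) with h | h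
  · refine le_trans ?_ (gradBracket_monotone_of_le hα₁ hα₂ p q h)
    gcongr
    exact inv_le_bracket_rpow hα₁ hα₂ hp
  · rw [← neg_sub q p, ← neg_sub (gradBracket α q), inner_neg_neg, norm_neg]
    refine le_trans ?_ (gradBracket_monotone_of_le hα₁ hα₂ q p h)
    gcongr
    exact inv_le_bracket_rpow hα₁ hα₂ hq

/-- The gradient increment grows in every direction close enough to that of `p - q`. -/
lemma gradBracket_monotone_perturbed {α M K : ℝ} (hα₁ : 1 < α) (hα₂ : α ≤ 2)
    (hK : 5 ≤ K * (α - 1)) (p q e : E) (he : ‖e‖ ≤ 2)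
    (hp : bracket p ≤ M) (hq : bracket q ≤ M) :
    M⁻¹ * ‖p - q‖ ^ 2 ≤
      inner ℝ (gradBracket α p - gradBracket α q) (K • (p - q) + ‖p - q‖ • e) := by
  have key : ∀ p q e : E, ‖e‖ ≤ 2 → bracket p ≤ M → bracket q ≤ bracket p →
      M⁻¹ * ‖p - q‖ ^ 2 ≤
        inner ℝ (gradBracket α p - gradBracket α q) (K • (p - q) + ‖p - q‖ • e) := by
    intro p q e he hp h
    have hK0 : 0 ≤ K := by nlinarith
    have h₁ := gradBracket_monotone_of_le hα₁ hα₂ p q h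
    have h₂ := norm_gradBracket_sub_le_of_le hα₁ hα₂ p q h
    have h₃ := inv_le_bracket_rpow hα₁ hα₂ hp
    have h₄ := neg_le_of_abs_le (abs_real_inner_le_norm (gradBracket α p - gradBracket α q) e)
    have hw : 0 ≤ bracket p ^ (α - 2) := by have := one_le_bracket p; positivity
    rw [inner_add_right, real_inner_smul_right, real_inner_smul_right]
    set w := bracket p ^ (α - 2)
    set d := ‖p - q‖
    have hd : 0 ≤ d := norm_nonneg _
    have h₅ : ‖gradBracket α p - gradBracket α q‖ * ‖e‖ ≤ 2 * w * d * 2 := by gcongr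
    have h₆ : d * -(2 * w * d * 2) ≤ d * inner ℝ (gradBracket α p - gradBracket α q) e :=
      mul_le_mul_of_nonneg_left (by linarith) hd
    have h₇ := mul_le_mul_of_nonneg_left h₁ hK0
    have h₈ : 5 * (w * d ^ 2) ≤ K * (α - 1) * (w * d ^ 2) := by gcongr
    have h₉ : M⁻¹ * d ^ 2 ≤ w * d ^ 2 := by gcongr
    nlinarith
  rcases le_total (bracket q) (bracket p) with h | h
  · exact key p q e he hp h
  · have h' := key q p (-e) (by rwa [norm_neg]) hq h
    rw [norm_sub_rev q p] at h'
    convert h' using 1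
    rw [← neg_sub q p, ← neg_sub (gradBracket α q), ← inner_neg_neg]
    congr 1 <;> module

end Gradient

/-! ### Lattice points as Euclidean vectors -/

/-- A lattice point, seen as a vector of Euclidean space. -/
def latticeVec (n : Fin 3 → ℤ) : EuclideanSpace ℝ (Fin 3) := WithLp.toLp 2 fun i => (n i : ℝ)

@[simp] lemma latticeVec_apply (n : Fin 3 → ℤ) (i : Fin 3) : latticeVec n i = n i := rfl

lemma latticeVec_add (n m : Fin 3 → ℤ) : latticeVec (n + m) = latticeVec n + latticeVec m := by
  ext i; simp

lemma latticeVec_zsmul (k : ℤ) (n : Fin 3 → ℤ) : latticeVec (k • n) = (k : ℝ) • latticeVec n := by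
  ext i; simp

lemma norm_latticeVec (n : Fin 3 → ℤ) : ‖latticeVec n‖ = znorm n := by
  simp [EuclideanSpace.norm_eq, znorm]

lemma bracket_latticeVec (n : Fin 3 → ℤ) : bracket (latticeVec n) = jb n := by
  rw [bracket, EuclideanSpace.norm_sq_eq]
  simp [jb]

lemma abs_apply_le_norm (x : EuclideanSpace ℝ (Fin 3)) (i : Fin 3) : |x i| ≤ ‖x‖ :=
  PiLp.norm_apply_le x i

lemma inner_latticeVec_single (x : EuclideanSpace ℝ (Fin 3)) (i : Fin 3) (σ : ℤ) :
    inner ℝ x (latticeVec (Pi.single i σ)) = σ * x i := by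
  rw [PiLp.inner_apply, Finset.sum_eq_single i]
  · simp
  · intro j _ hj
    simp [Pi.single_eq_of_ne hj]
  · simp

/-- Some coordinate of `y` has size at least a third of `⟪y, x⟫ / ‖x‖`. -/
lemma exists_coord_ge {x y : EuclideanSpace ℝ (Fin 3)} {κ : ℝ} (hx : 0 < ‖x‖)
    (h : κ * ‖x‖ ^ 2 ≤ inner ℝ y x) : ∃ i, κ * ‖x‖ / 3 ≤ |y i| := by
  by_contra! hlt
  have hi : ∀ i, inner ℝ (y i) (x i) < κ * ‖x‖ / 3 * ‖x‖ := by
    intro i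
    calc inner ℝ (y i) (x i) ≤ |y i| * |x i| := real_inner_le_norm _ _
      _ ≤ |y i| * ‖x‖ := by gcongr; exact abs_apply_le_norm x i
      _ < κ * ‖x‖ / 3 * ‖x‖ := by gcongr; exact hlt i
  rw [PiLp.inner_apply, Fin.sum_univ_three] at h
  linarith [hi 0, hi 1, hi 2]

/-! ### The sum phase -/

/-- Counting for `⟨a + n⟩ ^ α + ⟨n⟩ ^ α` away from its critical point `-a / 2`. -/
lemma card_le_of_sum_phase {α : ℝ} (hα₁ : 1 < α) (hα₂ : α ≤ 2) (a : Fin 3 → ℤ)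
    (T : Finset (Fin 3 → ℤ)) (c : Fin 3 → ℝ) {ρ M R : ℝ} (hρ : 1 ≤ ρ) (hR : 0 < R) (hM : 1 ≤ M)
    (hT : ∀ n ∈ T, ∀ i, |(n i : ℝ) - c i| ≤ ρ)
    (hMa : ∀ n ∈ T, bracket (latticeVec a + latticeVec n) ≤ M)
    (hMn : ∀ n ∈ T, bracket (latticeVec n) ≤ M)
    (hb : ∀ n ∈ T, R ≤ ‖latticeVec a + (2 : ℝ) • latticeVec n‖)
    (hosc : ∀ n ∈ T, ∀ m ∈ T,
      bracket (latticeVec a + latticeVec m) ^ α + bracket (latticeVec m) ^ α ≤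
        bracket (latticeVec a + latticeVec n) ^ α + bracket (latticeVec n) ^ α + 4) :
    (T.card : ℝ) ≤ 4374 * ρ ^ 2 * (12 * M / ((α - 1) * R) + 1) := by
  have hα : 0 < α - 1 := by linarith
  let G : (Fin 3 → ℤ) → EuclideanSpace ℝ (Fin 3) := fun n =>
    gradBracket α (latticeVec a + latticeVec n) + gradBracket α (latticeVec n)
  let κ : ℝ := (α - 1) * M⁻¹ * R / 3
  have hκ : 0 < κ := by positivity
  let U : Fin 3 × ℤ → Finset (Fin 3 → ℤ) := fun x => T.filter fun n => κ ≤ x.2 * G n x.1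
  let I : Finset (Fin 3 × ℤ) := Finset.univ ×ˢ {1, -1}
  have hcover : T ⊆ I.biUnion U := by
    intro n hn
    have hbn := hb n hn
    have hmono := gradBracket_monotone hα₁ hα₂ (latticeVec a + latticeVec n) (-latticeVec n)
      (hMa n hn) (by rw [bracket_neg]; exact hMn n hn)
    have hsub : latticeVec a + latticeVec n - -latticeVec n =
        latticeVec a + (2 : ℝ) • latticeVec n := by module
    rw [hsub, gradBracket_neg, sub_neg_eq_add] at hmono
    obtain ⟨i, hi⟩ := exists_coord_ge (hR.trans_le hbn) hmono
    have hκi : κ ≤ |G n i| := le_trans (by simp only [κ]; gcongr) hi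
    rw [Finset.mem_biUnion]
    rcases le_abs.1 hκi with h | h
    · exact ⟨(i, 1), by simp [I], by simp [U, hn, h]⟩
    · exact ⟨(i, -1), by simp [I], Finset.mem_filter.2 ⟨hn, by simpa using h⟩⟩
  have hU : ∀ x ∈ I, ((U x).card : ℝ) ≤ 729 * ρ ^ 2 * (12 * M / ((α - 1) * R) + 1) := by
    rintro ⟨i, σ⟩ hx
    have hσ : |(σ : ℝ)| ≤ 1 := by
      have : σ = 1 ∨ σ = -1 := by simpa [I] using hx
      rcases this with rfl | rfl <;> simp
    refine (card_le_of_step_bound (U (i, σ)) c ρ 1 (12 * M / ((α - 1) * R)) hρ zero_le_one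
      (by positivity) (Pi.single i σ) ?_ (fun n hn => hT n (Finset.mem_of_mem_filter n hn))
      ?_).trans_eq (by norm_num)
    · intro j
      rcases eq_or_ne j i with rfl | hj
      · simpa using hσ
      · simp [Pi.single_eq_of_ne hj]
    · intro n hn k hk
      obtain ⟨hnT, hnκ⟩ := Finset.mem_filter.1 hn
      have hkT := Finset.mem_of_mem_filter _ hk
      have ho := hosc n hnT _ hkT
      have hvec : latticeVec (n + (k : ℤ) • Pi.single i σ) =
          latticeVec n + (k : ℝ) • latticeVec (Pi.single i σ) := by
        rw [latticeVec_add, latticeVec_zsmul, Int.cast_natCast]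
      rw [hvec] at ho
      have t₁ := bracket_rpow_tangent hα₁.le (latticeVec n)
        (latticeVec n + (k : ℝ) • latticeVec (Pi.single i σ))
      have t₂ := bracket_rpow_tangent hα₁.le (latticeVec a + latticeVec n)
        (latticeVec a + (latticeVec n + (k : ℝ) • latticeVec (Pi.single i σ)))
      rw [add_sub_cancel_left, real_inner_smul_right, inner_latticeVec_single] at t₁
      rw [← add_assoc, add_sub_cancel_left, real_inner_smul_right, inner_latticeVec_single,
        add_assoc] at t₂
      have hG : G n i = gradBracket α (latticeVec a + latticeVec n) i +
        gradBracket α (latticeVec n) i := rfl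
      have hαk : α * (k * (σ * G n i)) ≤ 4 := by rw [hG]; linarith
      have hkκ : k * κ ≤ 4 := by
        have h₁ : (k : ℝ) * κ ≤ k * (σ * G n i) := by gcongr
        have h₂ : 0 ≤ (k : ℝ) * κ := by positivity
        nlinarith
      rw [le_div_iff₀ (by positivity)]
      have hκM : κ * (3 * M) = (α - 1) * R := by simp only [κ]; field_simp
      rw [← hκM]
      nlinarith
  calc (T.card : ℝ) ≤ ∑ x ∈ I, ((U x).card : ℝ) := by
        exact_mod_cast (Finset.card_le_card hcover).trans Finset.card_biUnion_le
    _ ≤ I.card • (729 * ρ ^ 2 * (12 * M / ((α - 1) * R) + 1)) := Finset.sum_le_card_nsmul _ _ _ hU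
    _ = 4374 * ρ ^ 2 * (12 * M / ((α - 1) * R) + 1) := by
        have hI : I.card = 6 := by simp [I]
        rw [hI, nsmul_eq_mul]; push_cast; ring

/-- Counting for `⟨a + n⟩ ^ α + ⟨n⟩ ^ α` in a ball around its critical point `-a / 2`. -/
lemma card_le_of_sum_phase_ball {α : ℝ} (hα₁ : 1 < α) (hα₂ : α ≤ 2) (a : Fin 3 → ℤ)
    {M : ℝ} (hM : 1 ≤ M) (j : ℕ) (T : Finset (Fin 3 → ℤ))
    (hMa : ∀ n ∈ T, bracket (latticeVec a + latticeVec n) ≤ M)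
    (hMn : ∀ n ∈ T, bracket (latticeVec n) ≤ M)
    (hb : ∀ n ∈ T, ‖latticeVec a + (2 : ℝ) • latticeVec n‖ ≤ 2 ^ j)
    (hosc : ∀ n ∈ T, ∀ m ∈ T,
      bracket (latticeVec a + latticeVec m) ^ α + bracket (latticeVec m) ^ α ≤
        bracket (latticeVec a + latticeVec n) ^ α + bracket (latticeVec n) ^ α + 4) :
    (T.card : ℝ) ≤ 52488 / (α - 1) * 2 ^ j * (2 ^ j + M) := by
  have hα : 0 < α - 1 := by linarith
  have hcube : ∀ n : Fin 3 → ℤ, ∀ r : ℝ, ‖latticeVec a + (2 : ℝ) • latticeVec n‖ ≤ 2 * r →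
      ∀ i, |(n i : ℝ) - -(a i : ℝ) / 2| ≤ r := by
    intro n r h i
    have h' := abs_le.1 ((abs_apply_le_norm _ i).trans h)
    simp only [PiLp.add_apply, PiLp.smul_apply, latticeVec_apply, smul_eq_mul] at h'
    rw [abs_le]
    constructor <;> linarith
  have hC : 52488 ≤ 52488 / (α - 1) := by
    rw [le_div_iff₀ hα]; linarith
  induction j generalizing T with
  | zero =>
    have h := card_le_of_mem_cube T _ 1 le_rfl fun n hn =>
      hcube n 1 ((hb n hn).trans (by norm_num))
    rw [pow_zero, mul_one]
    nlinarith
  | succ j ih =>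
    let T₁ := T.filter fun n => ‖latticeVec a + (2 : ℝ) • latticeVec n‖ ≤ 2 ^ j
    let T₂ := T.filter fun n => ¬ ‖latticeVec a + (2 : ℝ) • latticeVec n‖ ≤ 2 ^ j
    have hsub₁ : ∀ n ∈ T₁, n ∈ T := fun n hn => Finset.mem_of_mem_filter n hn
    have hsub₂ : ∀ n ∈ T₂, n ∈ T := fun n hn => Finset.mem_of_mem_filter n hn
    have h₁ := ih T₁ (fun n hn => hMa n (hsub₁ n hn)) (fun n hn => hMn n (hsub₁ n hn))
      (fun n hn => (Finset.mem_filter.1 hn).2)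
      (fun n hn m hm => hosc n (hsub₁ n hn) m (hsub₁ m hm))
    have h₂ := card_le_of_sum_phase (R := 2 ^ j) (ρ := 2 ^ j) (M := M) hα₁ hα₂ a T₂ _
      (one_le_pow₀ one_le_two) (by positivity) hM
      (fun n hn => hcube n _ ((hb n (hsub₂ n hn)).trans_eq (pow_succ' 2 j)))
      (fun n hn => hMa n (hsub₂ n hn)) (fun n hn => hMn n (hsub₂ n hn))
      (fun n hn => (not_le.1 (Finset.mem_filter.1 hn).2).le)
      (fun n hn m hm => hosc n (hsub₂ n hn) m (hsub₂ m hm))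
    have hcard : (T.card : ℝ) = T₁.card + T₂.card := by
      exact_mod_cast (Finset.card_filter_add_card_filter_not _).symm
    have hp : (0 : ℝ) < 2 ^ j := by positivity
    have heq : 4374 * ((2 : ℝ) ^ j) ^ 2 * (12 * M / ((α - 1) * 2 ^ j) + 1) =
        52488 / (α - 1) * 2 ^ j * M + 4374 * (2 ^ j * 2 ^ j) := by
      field_simp; ring
    rw [hcard, pow_succ]
    rw [heq] at h₂
    have hpp : 4374 * ((2 : ℝ) ^ j * 2 ^ j) ≤ 52488 / (α - 1) * (2 ^ j * 2 ^ j) := by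
      gcongr; linarith
    nlinarith [mul_pos hp hp]

/-! ### The difference phase -/

/-- A nonzero vector is approximated in direction by a lattice vector of bounded size. -/
lemma exists_latticeVec_approx (x : EuclideanSpace ℝ (Fin 3)) (K : ℝ) (hK : 0 ≤ K) (hx : 0 < ‖x‖) :
    ∃ (v : Fin 3 → ℤ) (e : EuclideanSpace ℝ (Fin 3)), ‖e‖ ≤ 2 ∧ (∀ i, |(v i : ℝ)| ≤ K + 1) ∧
      ‖x‖ • latticeVec v = K • x + ‖x‖ • e := by
  let v : Fin 3 → ℤ := fun i => ⌊K / ‖x‖ * x i⌋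
  let e : EuclideanSpace ℝ (Fin 3) := latticeVec v - (K / ‖x‖) • x
  have he : ∀ i, e i = ⌊K / ‖x‖ * x i⌋ - K / ‖x‖ * x i := fun i => rfl
  have he₁ : ∀ i, |e i| ≤ 1 := by
    intro i
    rw [he, abs_le]
    constructor <;> linarith [Int.floor_le (K / ‖x‖ * x i), Int.lt_floor_add_one (K / ‖x‖ * x i)]
  refine ⟨v, e, ?_, ?_, ?_⟩
  · have hsq : ‖e‖ ^ 2 ≤ 2 ^ 2 := by
      rw [EuclideanSpace.norm_sq_eq, Fin.sum_univ_three]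
      have h : ∀ i, ‖e i‖ ^ 2 ≤ 1 := fun i => pow_le_one₀ (norm_nonneg _) (he₁ i)
      linarith [h 0, h 1, h 2]
    exact le_of_sq_le_sq hsq (by norm_num)
  · intro i
    have hv : (v i : ℝ) = e i + K / ‖x‖ * x i := by rw [he]; ring
    have hKx : |K / ‖x‖ * x i| ≤ K := by
      rw [abs_mul, abs_of_nonneg (by positivity : 0 ≤ K / ‖x‖)]
      calc K / ‖x‖ * |x i| ≤ K / ‖x‖ * ‖x‖ := by gcongr; exact abs_apply_le_norm x i
        _ = K := by field_simp
    rw [hv]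
    linarith [abs_add_le (e i) (K / ‖x‖ * x i), he₁ i]
  · simp only [e]
    rw [smul_sub, smul_smul, mul_div_cancel₀ _ hx.ne']
    module

/-- Counting for `⟨a + n⟩ ^ α - ⟨n⟩ ^ α`. -/
lemma card_le_of_difference_phase {α : ℝ} (hα₁ : 1 < α) (hα₂ : α ≤ 2) (a : Fin 3 → ℤ)
    (T : Finset (Fin 3 → ℤ)) {N M : ℝ} (hN : 1 ≤ N) (ha : 0 < ‖latticeVec a‖)
    (hM : 1 + ‖latticeVec a‖ + N ≤ M) (hT : ∀ n ∈ T, ‖latticeVec n‖ ≤ N)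
    (hosc : ∀ n ∈ T, ∀ m ∈ T,
      bracket (latticeVec a + latticeVec m) ^ α - bracket (latticeVec m) ^ α ≤
        bracket (latticeVec a + latticeVec n) ^ α - bracket (latticeVec n) ^ α + 4) :
    (T.card : ℝ) ≤ 27 * (1 + 2 * (5 / (α - 1) + 1)) ^ 3 * N ^ 2 *
      (4 * M / ‖latticeVec a‖ + 1) := by
  have hα : 0 < α - 1 := by linarith
  obtain ⟨v, e, he, hv, hve⟩ := exists_latticeVec_approx (latticeVec a) (5 / (α - 1))
    (by positivity) ha
  have hM0 : 0 < M := by linarith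
  refine card_le_of_step_bound T 0 N (5 / (α - 1) + 1) (4 * M / ‖latticeVec a‖) hN
    (by positivity) (by positivity) v hv ?_ ?_
  · intro n hn i
    simpa using (abs_apply_le_norm (latticeVec n) i).trans (hT n hn)
  · intro n hn k hk
    rcases Nat.eq_zero_or_pos k with rfl | hk0
    · simp only [Nat.cast_zero]; positivity
    have hkR : (0 : ℝ) < k := by exact_mod_cast hk0
    have hvec : latticeVec (n + (k : ℤ) • v) = latticeVec n + (k : ℝ) • latticeVec v := by
      rw [latticeVec_add, latticeVec_zsmul, Int.cast_natCast]
    have ho := hosc n hn _ hk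
    have hTk := hT _ hk
    rw [hvec] at ho hTk
    let ψ : ℝ → ℝ := fun s => bracket (latticeVec a + latticeVec n + s • latticeVec v) ^ α -
      bracket (latticeVec n + s • latticeVec v) ^ α
    have hψ : ∀ s, HasDerivAt ψ
        (α * inner ℝ (gradBracket α (latticeVec a + latticeVec n + s • latticeVec v))
            (latticeVec v) -
          α * inner ℝ (gradBracket α (latticeVec n + s • latticeVec v)) (latticeVec v)) s :=
      fun s => (hasDerivAt_bracket_rpow α _ _ s).sub (hasDerivAt_bracket_rpow α _ _ s)
    obtain ⟨s, hs, hslope⟩ := exists_hasDerivAt_eq_slope ψ _ hkR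
      (fun s _ => (hψ s).continuousAt.continuousWithinAt) (fun s _ => hψ s)
    have hball : ‖latticeVec n + s • latticeVec v‖ ≤ N := by
      have h := (convex_closedBall (0 : EuclideanSpace ℝ (Fin 3)) N).add_smul_sub_mem
        (mem_closedBall_zero_iff.2 (hT n hn)) (mem_closedBall_zero_iff.2 hTk)
        (t := s / k) ⟨div_nonneg hs.1.le hkR.le, (div_le_one hkR).2 hs.2.le⟩
      rwa [add_sub_cancel_left, smul_smul, div_mul_cancel₀ _ hkR.ne',
        mem_closedBall_zero_iff] at h
    have hq : bracket (latticeVec n + s • latticeVec v) ≤ M := by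
      linarith [bracket_le (latticeVec n + s • latticeVec v)]
    have hp : bracket (latticeVec a + latticeVec n + s • latticeVec v) ≤ M := by
      rw [add_assoc]
      linarith [bracket_le (latticeVec a + (latticeVec n + s • latticeVec v)),
        norm_add_le (latticeVec a) (latticeVec n + s • latticeVec v)]
    have hgrad := gradBracket_monotone_perturbed (K := 5 / (α - 1)) hα₁ hα₂
      (div_mul_cancel₀ 5 hα.ne').ge _ _ e he hp hq
    have hd : latticeVec a + latticeVec n + s • latticeVec v -
        (latticeVec n + s • latticeVec v) = latticeVec a := by module
    rw [hd, ← hve, real_inner_smul_right, inner_sub_left] at hgrad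
    rw [← mul_sub, sub_zero] at hslope
    set g := inner ℝ (gradBracket α (latticeVec a + latticeVec n + s • latticeVec v))
      (latticeVec v) - inner ℝ (gradBracket α (latticeVec n + s • latticeVec v)) (latticeVec v)
    have hg : M⁻¹ * ‖latticeVec a‖ ≤ g :=
      le_of_mul_le_mul_left (by linarith) ha
    have hg0 : 0 ≤ g := le_trans (by positivity) hg
    have hdiff : ψ k - ψ 0 ≤ 4 := by
      simp only [ψ, zero_smul, add_zero]
      rw [add_assoc]
      linarith
    have hαg : α * g * k ≤ 4 := by
      rw [hslope, div_mul_cancel₀ _ hkR.ne']; exact hdiff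
    have hgk : M⁻¹ * ‖latticeVec a‖ * k ≤ 4 := by
      have h₁ : M⁻¹ * ‖latticeVec a‖ * k ≤ g * k := by gcongr
      nlinarith [mul_nonneg hg0 hkR.le]
    rw [le_div_iff₀ ha]
    calc (k : ℝ) * ‖latticeVec a‖ = M⁻¹ * ‖latticeVec a‖ * k * M := by field_simp
      _ ≤ 4 * M := by gcongr

/-! ### Conclusion -/

lemma abs_jbb_sub_le {α : ℝ} (hα : 0 ≤ α) (n : Fin 3 → ℤ) :
    |jbb α n - bracket (latticeVec n) ^ α| ≤ 1 / 2 := by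
  have h₁ := Real.one_le_rpow (one_le_bracket (latticeVec n)) hα
  have h₀ : 0 ≤ bracket (latticeVec n) := by linarith [one_le_bracket (latticeVec n)]
  rw [jbb, ← bracket_latticeVec, mul_comm, Real.rpow_mul h₀, Real.rpow_two]
  set y := bracket (latticeVec n) ^ α
  have h₂ : Real.sqrt (y ^ 2 - 1 / 4) ≤ y := Real.sqrt_le_iff.2 ⟨by linarith, by linarith⟩
  have h₃ : y - 1 / 2 ≤ Real.sqrt (y ^ 2 - 1 / 4) := Real.le_sqrt_of_sq_le (by nlinarith)
  rw [abs_le]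
  constructor <;> linarith

lemma IsDyadic.one_le {N : ℝ} (h : IsDyadic N) : 1 ≤ N := by
  obtain ⟨j, rfl⟩ := h
  exact one_le_pow₀ one_le_two

lemma SimFreq.norm_le {N : ℝ} {n : Fin 3 → ℤ} (hN : 1 ≤ N) (h : SimFreq N n) :
    ‖latticeVec n‖ ≤ N := by
  rw [norm_latticeVec]
  rcases h with h | h
  · exact h.2.2
  · linarith [h.2]

/-- The sum-phase count for `|a| ≥ A / 2`, `|n| ≤ N`. -/
lemma card_le_sq_of_sum_phase {α : ℝ} (hα₁ : 1 < α) (hα₂ : α ≤ 2) (a : Fin 3 → ℤ)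
    (T : Finset (Fin 3 → ℤ)) {N A : ℝ} (hN : IsDyadic N)
    (haA : A / 2 ≤ ‖latticeVec a‖) (haA' : ‖latticeVec a‖ ≤ A) (hT : ∀ n ∈ T, ‖latticeVec n‖ ≤ N)
    (hosc : ∀ n ∈ T, ∀ m ∈ T,
      bracket (latticeVec a + latticeVec m) ^ α + bracket (latticeVec m) ^ α ≤
        bracket (latticeVec a + latticeVec n) ^ α + bracket (latticeVec n) ^ α + 4) :
    (T.card : ℝ) ≤ 416 * (52488 / (α - 1)) * N ^ 2 := by
  have hα : 0 < α - 1 := by linarith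
  have hN₁ := hN.one_le
  have hMa : ∀ n ∈ T, bracket (latticeVec a + latticeVec n) ≤ 1 + A + N := fun n hn => by
    linarith [bracket_le (latticeVec a + latticeVec n),
      norm_add_le (latticeVec a) (latticeVec n), hT n hn]
  have hMn : ∀ n ∈ T, bracket (latticeVec n) ≤ 1 + A + N := fun n hn => by
    linarith [bracket_le (latticeVec n), hT n hn, norm_nonneg (latticeVec a)]
  have h2n : ∀ n ∈ T, ‖(2 : ℝ) • latticeVec n‖ ≤ 2 * N := fun n hn => by
    rw [norm_smul, Real.norm_ofNat]; linarith [hT n hn]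
  rcases le_or_gt (8 * N) A with hA | hA
  · have hA0 : 0 < A := by linarith
    have h := card_le_of_sum_phase (R := A / 4) (ρ := N) (M := 3 * A) hα₁ hα₂ a T 0 hN₁
      (by linarith) (by linarith)
      (fun n hn i => by simpa using (abs_apply_le_norm (latticeVec n) i).trans (hT n hn))
      (fun n hn => (hMa n hn).trans (by linarith)) (fun n hn => (hMn n hn).trans (by linarith))
      (fun n hn => by
        have := norm_sub_le_norm_add (latticeVec a) ((2 : ℝ) • latticeVec n)
        linarith [h2n n hn]) hosc
    have heq : 12 * (3 * A) / ((α - 1) * (A / 4)) = 144 / (α - 1) := by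
      field_simp; ring
    rw [heq] at h
    have h₁ : 1 ≤ 1 / (α - 1) := by rw [le_div_iff₀ hα]; linarith
    refine h.trans ?_
    calc 4374 * N ^ 2 * (144 / (α - 1) + 1)
        ≤ 4374 * N ^ 2 * (144 / (α - 1) + 1 / (α - 1)) := by gcongr
      _ = 634230 / (α - 1) * N ^ 2 := by ring
      _ ≤ 21835008 / (α - 1) * N ^ 2 := by gcongr; norm_num
      _ = 416 * (52488 / (α - 1)) * N ^ 2 := by ring
  · obtain ⟨m, hm⟩ := hN
    have h16 : (2 : ℝ) ^ (m + 4) = 16 * N := by rw [hm, pow_add]; ring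
    have h := card_le_of_sum_phase_ball (M := 10 * N) hα₁ hα₂ a (by linarith) (m + 4) T
      (fun n hn => (hMa n hn).trans (by linarith)) (fun n hn => (hMn n hn).trans (by linarith))
      (fun n hn => by
        rw [h16]
        linarith [norm_add_le (latticeVec a) ((2 : ℝ) • latticeVec n), h2n n hn]) hosc
    rw [h16] at h
    exact h.trans_eq (by ring)

/-- **Basic counting estimate for the fractional wave phase** (Lemma 3.1):
for `1 < α ≤ 2` there is a constant `C = C(α) > 0` such that for all dyadic `N, A ≥ 1`,
all `a ∈ ℤ³` with `|a| ∼ A`, every sign `ς` and every `ζ ∈ ℝ`,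
`#{ n ∈ ℤ³ : |n| ∼ N, |⟪a+n⟫ + ς⟪n⟫ − ζ| ≤ 1 } ≤ C · min(A,N)⁻¹ · N³`. -/
theorem basic_counting_fractional_wave (α : ℝ) (hα₁ : 1 < α) (hα₂ : α ≤ 2) :
    ∃ C : ℝ, 0 < C ∧
      ∀ N A : ℝ, IsDyadic N → IsDyadic A →
        ∀ a : Fin 3 → ℤ, SimFreq A a → ∀ ς : ℝ, IsSign ς → ∀ ζ : ℝ,
          ∀ S : Set (Fin 3 → ℤ),
            S = {n | SimFreq N n ∧ |jbb α (a + n) + ς * jbb α n - ζ| ≤ 1} →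
            S.Finite ∧ (S.ncard : ℝ) ≤ C * (min A N)⁻¹ * N ^ 3 := by
  have hα : 0 < α - 1 := by linarith
  obtain ⟨C₁, hC₁⟩ : ∃ C₁ : ℝ, C₁ = 416 * (52488 / (α - 1)) := ⟨_, rfl⟩
  obtain ⟨C₂, hC₂⟩ : ∃ C₂ : ℝ, C₂ = 27 * (1 + 2 * (5 / (α - 1) + 1)) ^ 3 := ⟨_, rfl⟩
  have hC₁0 : 0 < C₁ := by rw [hC₁]; positivity
  have hC₂0 : 0 < C₂ := by rw [hC₂]; positivity
  refine ⟨54 + C₁ + 25 * C₂, by positivity, ?_⟩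
  intro N A hN hA a ha ς hς ζ S hS
  have hN₁ := hN.one_le
  have hA₁ := hA.one_le
  have hSN : ∀ n ∈ S, ‖latticeVec n‖ ≤ N := fun n hn => by
    rw [hS] at hn; exact hn.1.norm_le hN₁
  have hcoord : ∀ n ∈ S, ∀ i, |(n i : ℝ)| ≤ N := fun n hn i =>
    (abs_apply_le_norm (latticeVec n) i).trans (hSN n hn)
  have hfin : S.Finite := by
    refine (Finset.finite_toSet (Fintype.piFinset fun _ : Fin 3 =>
      Finset.Icc ⌈-N⌉ ⌊N⌋)).subset fun n hn => ?_
    rw [Finset.mem_coe, Fintype.mem_piFinset]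
    intro i
    rw [Finset.mem_Icc, Int.ceil_le, Int.le_floor]
    exact abs_le.1 (hcoord n hn i)
  refine ⟨hfin, ?_⟩
  obtain ⟨T, rfl⟩ := hfin.exists_finset_coe
  rw [Set.ncard_coe_finset]
  have hphase : ∀ n ∈ T, |bracket (latticeVec a + latticeVec n) ^ α +
      ς * bracket (latticeVec n) ^ α - ζ| ≤ 2 := by
    intro n hn
    have hn' : n ∈ (T : Set (Fin 3 → ℤ)) := hn
    rw [hS] at hn'
    have h₀ := abs_le.1 hn'.2
    have h₁ := abs_le.1 (abs_jbb_sub_le (by linarith : 0 ≤ α) (a + n))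
    have h₂ := abs_le.1 (abs_jbb_sub_le (by linarith : 0 ≤ α) n)
    rw [latticeVec_add] at h₁
    rw [abs_le]
    rcases hς with rfl | rfl <;> constructor <;> linarith [h₀.1, h₀.2, h₁.1, h₁.2, h₂.1, h₂.2]
  have hmin0 : 0 < min A N := lt_min (by linarith) (by linarith)
  obtain ⟨μ, hμ⟩ : ∃ μ : ℝ, μ = N / min A N := ⟨_, rfl⟩
  have hμ₁ : 1 ≤ μ := by rw [hμ, le_div_iff₀ hmin0, one_mul]; exact min_le_right _ _
  have hμA : N / A ≤ μ := by rw [hμ]; gcongr; exact min_le_left _ _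
  have hgoal : (54 + C₁ + 25 * C₂) * (min A N)⁻¹ * N ^ 3 = (54 + C₁ + 25 * C₂) * (N ^ 2 * μ) := by
    rw [hμ]; ring
  rw [hgoal]
  have hN2 : 0 < N ^ 2 := by positivity
  rcases lt_or_ge A 2 with hA2 | hA2
  · have h := card_le_of_mem_cube T 0 N hN₁ fun n hn i => by simpa using hcoord n hn i
    have hNμ : N ≤ 2 * μ := by
      have : N / 2 ≤ N / A := by gcongr
      linarith
    calc (T.card : ℝ) ≤ 27 * N ^ 3 := h
      _ = 27 * (N ^ 2 * N) := by ring
      _ ≤ 27 * (N ^ 2 * (2 * μ)) := by gcongr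
      _ = 54 * (N ^ 2 * μ) := by ring
      _ ≤ (54 + C₁ + 25 * C₂) * (N ^ 2 * μ) := by gcongr; linarith
  have haA : A / 2 ≤ ‖latticeVec a‖ := by
    rw [norm_latticeVec]
    rcases ha with h | h
    · exact h.2.1.le
    · linarith [h.1]
  have haA' := ha.norm_le hA₁
  rcases hς with rfl | rfl
  · have h := card_le_sq_of_sum_phase hα₁ hα₂ a T hN haA haA' hSN fun n hn m hm => by
      linarith [abs_le.1 (hphase n hn), abs_le.1 (hphase m hm)]
    rw [← hC₁] at h
    calc (T.card : ℝ) ≤ C₁ * (N ^ 2 * 1) := by rwa [mul_one]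
      _ ≤ (54 + C₁ + 25 * C₂) * (N ^ 2 * μ) := by gcongr; linarith
  · have h := card_le_of_difference_phase (M := 1 + A + N) hα₁ hα₂ a T hN₁ (by linarith)
      (by linarith) hSN fun n hn m hm => by
        linarith [(abs_le.1 (hphase n hn)).1, (abs_le.1 (hphase m hm)).2]
    rw [← hC₂] at h
    have hX : 4 * (1 + A + N) / ‖latticeVec a‖ + 1 ≤ 25 * μ := by
      calc 4 * (1 + A + N) / ‖latticeVec a‖ + 1 ≤ 4 * (A + A + N) / (A / 2) + 1 := by gcongr
        _ = 17 + 8 * (N / A) := by field_simp; ring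
        _ ≤ 25 * μ := by linarith
    calc (T.card : ℝ) ≤ C₂ * N ^ 2 * (25 * μ) := h.trans (by gcongr)
      _ = 25 * C₂ * (N ^ 2 * μ) := by ring
      _ ≤ (54 + C₁ + 25 * C₂) * (N ^ 2 * μ) := by gcongr; linarith
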